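/- For every integer d ≥ 2 there exist constants C > 0 and z₀ > 0 such that for all real z ≥ z₀: | d!·N^D(z)·z^{−d/2} − ( 1 − (d·(1 + 2ψ(w(z)))/2)·z^{−1/2} + (d(d−1)/2)·((1/2 + ψ(w(z)))² + (d−2)/6)·z^{−1} ) | ≤ C·z^{−3/2}, where w(z) = ((1−d) + √((d−1)² + 4z))/2 is the unique nonnegative solution of w(w+d−1) = z. -/

import Mathlib

/-- Counting function of the Dirichlet Laplacian eigenvalues on the hemisphere `S^d₊`:
the eigenvalues are `l(l+d−1)` with multiplicity `C(d+l−2, d−1)`, for integers `l ≥ 1`. -/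
noncomputable def NDhemi (d : ℕ) (z : ℝ) : ℝ :=
  ∑' l : ℕ,
    if 1 ≤ l ∧ (l : ℝ) * ((l : ℝ) + (d : ℝ) - 1) ≤ z then
      (Nat.choose (d + l - 2) (d - 1) : ℝ) else 0

/-- The fluctuation function `ψ(η) = η − ⌊η⌋ − 1/2`. -/
noncomputable def psi (η : ℝ) : ℝ := η - (⌊η⌋ : ℝ) - 1 / 2

/-- The unique nonnegative solution `w` of `w(w+d−1) = z`. -/
noncomputable def wvar (d : ℕ) (z : ℝ) : ℝ :=
  ((1 - (d : ℝ)) + Real.sqrt (((d : ℝ) - 1) ^ 2 + 4 * z)) / 2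

lemma prod_expansion (c q : ℝ) (m : ℕ) : ∃ R : ℝ × ℝ × ℝ → ℝ, Continuous R ∧ ∀ e t r : ℝ,
    ∏ k ∈ Finset.range m, (1 + ((k : ℝ) - c - t) * e + q * e ^ 2 + r * e ^ 3) =
      1 + ((m : ℝ) * (m - 1) / 2 - m * (c + t)) * e +
        (m * q + (((m : ℝ) * (m - 1) / 2 - m * (c + t)) ^ 2 -
          ((m : ℝ) * (m - 1) * (2 * m - 1) / 6 - (c + t) * m * (m - 1) + m * (c + t) ^ 2)) / 2)
          * e ^ 2 + R (e, t, r) * e ^ 3 := by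
  induction m with
  | zero => exact ⟨fun _ => 0, continuous_const, by intro e t r; simp⟩
  | succ m ih =>
    obtain ⟨R, hR, h⟩ := ih
    let A : ℝ → ℝ := fun t => (m : ℝ) * (m - 1) / 2 - m * (c + t)
    let B : ℝ → ℝ := fun t => (m * q + (((m : ℝ) * (m - 1) / 2 - m * (c + t)) ^ 2 -
          ((m : ℝ) * (m - 1) * (2 * m - 1) / 6 - (c + t) * m * (m - 1) + m * (c + t) ^ 2)) / 2)
    refine ⟨fun p => R p * (1 + ((m : ℝ) - c - p.2.1) * p.1 + q * p.1 ^ 2 + p.2.2 * p.1 ^ 3)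
      + p.2.2 + A p.2.1 * q + B p.2.1 * ((m : ℝ) - c - p.2.1)
      + (A p.2.1 * p.2.2 + B p.2.1 * q) * p.1 + B p.2.1 * p.2.2 * p.1 ^ 2, ?_, ?_⟩
    · simp only [A, B]
      fun_prop
    · intro e t r
      rw [Finset.prod_range_succ, h]
      simp only [A, B]
      push_cast
      ring

lemma sum_choose_aux (e n : ℕ) :
    ∑ l ∈ Finset.range (n + 1), (Nat.choose (e + l) (e + 1)) = Nat.choose (e + n + 1) (e + 2) := by
  induction n with
  | zero => simp
  | succ n ih =>
    rw [Finset.sum_range_succ, ih, show e + (n + 1) + 1 = (e + n + 1) + 1 by ring,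
      Nat.choose_succ_succ' (e + n + 1) (e + 1), show e + (n + 1) = e + n + 1 by ring]
    ring

lemma wvar_spec (d : ℕ) (z : ℝ) (hz : 0 ≤ z) : wvar d z * (wvar d z + d - 1) = z := by
  have h : 0 ≤ ((d : ℝ) - 1) ^ 2 + 4 * z := by positivity
  have := Real.sq_sqrt h
  unfold wvar
  linear_combination this / 4

lemma wvar_nonneg (d : ℕ) (z : ℝ) (hz : 0 ≤ z) : 0 ≤ wvar d z := by
  have : (d : ℝ) - 1 ≤ Real.sqrt (((d : ℝ) - 1) ^ 2 + 4 * z) :=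
    Real.le_sqrt_of_sq_le (by linarith)
  unfold wvar
  linarith

lemma ND_eq (d : ℕ) (hd : 2 ≤ d) (z : ℝ) (hz : 0 ≤ z) :
    (Nat.factorial d : ℝ) * NDhemi d z =
      ∏ k ∈ Finset.range d, ((⌊wvar d z⌋ : ℝ) + k) := by
  have hw := wvar_nonneg d z hz
  have hs := wvar_spec d z hz
  set w := wvar d z with hwdef
  have hd' : (2 : ℝ) ≤ d := by exact_mod_cast hd
  have key : ∀ l : ℕ, (l : ℝ) * ((l : ℝ) + (d : ℝ) - 1) ≤ z ↔ l ∈ Finset.range (⌊w⌋₊ + 1) := by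
    intro l
    rw [Finset.mem_range, Nat.lt_succ_iff, Nat.le_floor_iff hw]
    have hl : (0 : ℝ) ≤ l := Nat.cast_nonneg l
    constructor
    · intro h
      by_contra! hlt
      nlinarith
    · intro h
      nlinarith
  obtain ⟨e, rfl⟩ : ∃ e, d = e + 2 := ⟨d - 2, by omega⟩
  have h1 : NDhemi (e + 2) z = ((Nat.choose (e + ⌊w⌋₊ + 1) (e + 2) : ℕ) : ℝ) := by
    unfold NDhemi
    rw [tsum_eq_sum (s := Finset.range (⌊w⌋₊ + 1))]
    · rw [← sum_choose_aux, Nat.cast_sum]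
      refine Finset.sum_congr rfl fun l hl => ?_
      have e1 : e + 2 + l - 2 = e + l := by omega
      have e2 : e + 2 - 1 = e + 1 := by omega
      rw [e1, e2]
      rcases Nat.eq_zero_or_pos l with rfl | hpos
      · simp
      · rw [if_pos ⟨hpos, (key l).2 hl⟩]
    · intro l hl
      rw [if_neg]
      rintro ⟨_, h⟩
      exact hl ((key l).1 h)
  rw [h1, ← natCast_floor_eq_intCast_floor hw, ← Nat.cast_mul]
  have := Nat.ascFactorial_eq_factorial_mul_choose' ⌊w⌋₊ (e + 2)
  rw [show ⌊w⌋₊ + (e + 2) - 1 = e + ⌊w⌋₊ + 1 by omega] at this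
  rw [← this, Nat.ascFactorial_eq_prod_range]
  push_cast
  rfl

theorem counting_fn_dirichlet_hemisphere_three_term_asymptotics (d : ℕ) (hd : 2 ≤ d) :
    ∃ C > (0 : ℝ), ∃ z₀ > (0 : ℝ), ∀ z : ℝ, z₀ ≤ z →
      |(Nat.factorial d : ℝ) * NDhemi d z * z ^ (-(d : ℝ) / 2) -
          (1 - ((d : ℝ) * (1 + 2 * psi (wvar d z)) / 2) * z ^ (-(1 : ℝ) / 2) +
            ((d : ℝ) * ((d : ℝ) - 1) / 2) *
              ((1 / 2 + psi (wvar d z)) ^ 2 + ((d : ℝ) - 2) / 6) * z ^ (-(1 : ℝ)))| ≤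
        C * z ^ (-(3 : ℝ) / 2) := by
  set κ : ℝ := ((d : ℝ) - 1) ^ 2 / 4 with hκ
  have hκ0 : 0 ≤ κ := by positivity
  obtain ⟨R, hR, hexp⟩ := prod_expansion (((d : ℝ) - 1) / 2) (κ / 2) d
  have hK : IsCompact (Set.Icc (0 : ℝ) 1 ×ˢ Set.Icc (0 : ℝ) 1 ×ˢ Set.Icc (-(κ ^ 2 / 2)) (κ ^ 2 / 2)) :=
    isCompact_Icc.prod (isCompact_Icc.prod isCompact_Icc)
  obtain ⟨C, hC⟩ := hK.exists_bound_of_continuousOn hR.continuousOn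
  refine ⟨|C| + 1, by positivity, 1, one_pos, fun z hz => ?_⟩
  have hz0 : 0 < z := by linarith
  set ε : ℝ := z ^ (-(1 : ℝ) / 2) with hε
  have hεpos : 0 < ε := Real.rpow_pos_of_pos hz0 _
  have hε1 : ε ≤ 1 := Real.rpow_le_one_of_one_le_of_nonpos hz (by norm_num)
  have hε2 : z ^ (-(1 : ℝ)) = ε ^ 2 := by
    rw [hε, ← Real.rpow_mul_natCast hz0.le]; norm_num
  have hε3 : z ^ (-(3 : ℝ) / 2) = ε ^ 3 := by
    rw [hε, ← Real.rpow_mul_natCast hz0.le]; norm_num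
  have hεd : z ^ (-(d : ℝ) / 2) = ε ^ d := by
    rw [hε, ← Real.rpow_mul_natCast hz0.le]; congr 1; ring
  have hzε : z * ε ^ 2 = 1 := by
    rw [← hε2, Real.rpow_neg_one]; exact mul_inv_cancel₀ hz0.ne'
  rw [hε2, hε3, hεd, ND_eq d hd z hz0.le]
  set t : ℝ := 1 / 2 + psi (wvar d z) with ht
  have htw : t = wvar d z - ⌊wvar d z⌋ := by rw [ht, psi]; ring
  have ht0 : 0 ≤ t := by rw [htw]; linarith [Int.floor_le (wvar d z)]
  have ht1 : t ≤ 1 := by rw [htw]; linarith [Int.lt_floor_add_one (wvar d z)]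
  set S : ℝ := Real.sqrt (((d : ℝ) - 1) ^ 2 + 4 * z) / 2 * ε with hS
  have hS0 : 0 ≤ S := by positivity
  have hSsq : S ^ 2 = 1 + κ * ε ^ 2 := by
    have h : 0 ≤ ((d : ℝ) - 1) ^ 2 + 4 * z := by positivity
    have := Real.sq_sqrt h
    rw [hS, hκ]
    linear_combination this * ε ^ 2 / 4 + hzε
  have hx0 : 0 ≤ κ * ε ^ 2 := by positivity
  have hS1 : 1 ≤ S := by nlinarith
  have hS2 : S - 1 ≤ κ * ε ^ 2 := by nlinarith
  set r : ℝ := (S - 1 - κ / 2 * ε ^ 2) / ε ^ 3 with hr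
  have hrε : r * ε ^ 3 = S - 1 - κ / 2 * ε ^ 2 := by
    rw [hr]; field_simp
  have hid : S - 1 - κ / 2 * ε ^ 2 = -((S - 1) ^ 2 / 2) := by linear_combination hSsq / 2
  have hb : (S - 1) ^ 2 ≤ κ ^ 2 * ε ^ 3 := by
    calc (S - 1) ^ 2 ≤ (κ * ε ^ 2) ^ 2 := by gcongr
      _ = κ ^ 2 * ε ^ 3 * ε := by ring
      _ ≤ κ ^ 2 * ε ^ 3 * 1 := by gcongr
      _ = _ := by ring
  have hr1 : r ≤ κ ^ 2 / 2 := by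
    rw [hr, div_le_iff₀ (by positivity), hid]
    have : 0 ≤ κ ^ 2 / 2 * ε ^ 3 := by positivity
    nlinarith [sq_nonneg (S - 1)]
  have hr2 : -(κ ^ 2 / 2) ≤ r := by
    rw [hr, le_div_iff₀ (by positivity), hid]
    linarith
  have hbound := hC (ε, t, r) ⟨⟨hεpos.le, hε1⟩, ⟨ht0, ht1⟩, ⟨hr2, hr1⟩⟩
  have hprod : (∏ k ∈ Finset.range d, ((⌊wvar d z⌋ : ℝ) + k)) * ε ^ d =
      ∏ k ∈ Finset.range d, (1 + ((k : ℝ) - ((d : ℝ) - 1) / 2 - t) * ε + κ / 2 * ε ^ 2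
        + r * ε ^ 3) := by
    have : ε ^ d = ∏ _k ∈ Finset.range d, ε := by simp
    rw [this, ← Finset.prod_mul_distrib]
    refine Finset.prod_congr rfl fun k _ => ?_
    have hf : (⌊wvar d z⌋ : ℝ) = wvar d z - t := by rw [htw]; ring
    rw [hrε, hf, hS, wvar]
    ring
  have hpsi : psi (wvar d z) = t - 1 / 2 := by rw [ht]; ring
  rw [hprod, hexp, hpsi]
  have hfin : ∀ X : ℝ, X = R (ε, t, r) * ε ^ 3 → |X| ≤ (|C| + 1) * ε ^ 3 := by
    rintro X rfl
    rw [abs_mul, abs_of_pos (pow_pos hεpos 3)]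
    rw [Real.norm_eq_abs] at hbound
    gcongr
    linarith [le_abs_self C]
  apply hfin
  rw [hκ]
  ring
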